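/- Let (A_1,…,A_k) be a k-way partition of V with centers c_1,…,c_k and suppose that for every permutation π of {1,…,k} there is an index i ∈ {1,…,k} such that μ(A_i △ P_{π(i)}) ≥ (2ε/k)·μ(P_{π(i)}), where ε ∈ (0,1). If Ψ = 20^4·k^3/δ for some δ ∈ (0,1/2] and ε ≥ 64α·k^3/Ψ, then Cost({A_i,c_i}_{i=1}^k) > 2k^2·α/Ψ. -/

import Mathlib

open Finset BigOperators Matrix

namespace SpectralClustering

variable {V : Type} [Fintype V] [DecidableEq V]

/-- Volume of a vertex set: the sum of the degrees of its vertices. -/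
def vol (G : SimpleGraph V) [DecidableRel G.Adj] (S : Finset V) : ℕ :=
  ∑ v ∈ S, G.degree v

/-- Number of edges between two (disjoint) vertex sets. -/
def cut (G : SimpleGraph V) [DecidableRel G.Adj] (S T : Finset V) : ℕ :=
  ∑ u ∈ S, (T.filter fun v => G.Adj u v).card

/-- Conductance `φ(S) = |E(S, V \ S)| / μ(S)`. -/
noncomputable def conductance (G : SimpleGraph V) [DecidableRel G.Adj] (S : Finset V) : ℝ :=
  (cut G S Sᶜ : ℝ) / (vol G S : ℝ)

/-- A `k`-way partition of the vertex set into nonempty blocks. -/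
def IsKWayPartition {k : ℕ} (P : Fin k → Finset V) : Prop :=
  (∀ i, (P i).Nonempty) ∧ (∀ i j, i ≠ j → Disjoint (P i) (P j)) ∧
    (∀ v : V, ∃ i, v ∈ P i)

/-- Maximum conductance over the blocks of a tuple of sets. -/
noncomputable def maxCond (G : SimpleGraph V) [DecidableRel G.Adj] {k : ℕ}
    (P : Fin k → Finset V) : ℝ :=
  ⨆ i, conductance G (P i)

/-- Average conductance of the blocks. -/
noncomputable def avgCond (G : SimpleGraph V) [DecidableRel G.Adj] {k : ℕ}
    (P : Fin k → Finset V) : ℝ :=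
  (∑ i, conductance G (P i)) / (k : ℝ)

/-- `P` achieves `ρ̂_avr(k)`: it minimizes the maximum conductance among all
`k`-way partitions, and among those it has minimal average conductance. -/
def AchievesRhoAvr (G : SimpleGraph V) [DecidableRel G.Adj] {k : ℕ}
    (P : Fin k → Finset V) : Prop :=
  IsKWayPartition P ∧
  (∀ Q : Fin k → Finset V, IsKWayPartition Q → maxCond G P ≤ maxCond G Q) ∧
  (∀ Q : Fin k → Finset V, IsKWayPartition Q → maxCond G Q = maxCond G P →
    avgCond G P ≤ avgCond G Q)

/-- Dot product of two vectors indexed by the vertices. -/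
def dotV (x y : V → ℝ) : ℝ := ∑ v, x v * y v

/-- The normalized Laplacian `I - D^{-1/2} A D^{-1/2}`. -/
noncomputable def normLap (G : SimpleGraph V) [DecidableRel G.Adj] : Matrix V V ℝ :=
  1 - Matrix.diagonal (fun v => (Real.sqrt (G.degree v))⁻¹) * G.adjMatrix ℝ *
      Matrix.diagonal (fun v => (Real.sqrt (G.degree v))⁻¹)

/-- `f` is an orthonormal family of eigenvectors of the normalized Laplacian of `G`
with (sorted) eigenvalues `lam`. -/
structure EigenData (G : SimpleGraph V) [DecidableRel G.Adj]
    (f : Fin (Fintype.card V) → V → ℝ) (lam : Fin (Fintype.card V) → ℝ) : Prop where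
  eig : ∀ i, (normLap G).mulVec (f i) = lam i • f i
  ortho : ∀ i j, dotV (f i) (f j) = if i = j then (1 : ℝ) else 0
  mono : Monotone lam

/-- The gap parameter `Ψ = λ_{k+1} / ρ̂_avr(k)`, where `ρ̂_avr(k)` is realized as the
average conductance of the fixed optimal partition `P`. -/
noncomputable def Psi (G : SimpleGraph V) [DecidableRel G.Adj]
    (lam : Fin (Fintype.card V) → ℝ) {k : ℕ} (P : Fin k → Finset V)
    (hkn : k < Fintype.card V) : ℝ :=
  lam ⟨k, hkn⟩ / avgCond G P

/-- The spectral embedding `F(u) = d_u^{-1/2} (f_1(u), …, f_k(u))`. -/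
noncomputable def Femb (G : SimpleGraph V) [DecidableRel G.Adj]
    (f : Fin (Fintype.card V) → V → ℝ) {k : ℕ} (hk : k ≤ Fintype.card V) (u : V) :
    Fin k → ℝ :=
  fun j => f (Fin.castLE hk j) u / Real.sqrt (G.degree u)

/-- `k`-means cost of a clustering of the (degree-weighted) spectral embedding:
`∑_i ∑_{u ∈ A_i} d_u ‖F(u) - c_i‖²`. -/
noncomputable def kmCost (G : SimpleGraph V) [DecidableRel G.Adj]
    (f : Fin (Fintype.card V) → V → ℝ) {k : ℕ} (hk : k ≤ Fintype.card V) {ℓ : ℕ}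
    (A : Fin ℓ → Finset V) (c : Fin ℓ → Fin k → ℝ) : ℝ :=
  ∑ i, ∑ u ∈ A i, (G.degree u : ℝ) * ∑ j, (Femb G f hk u j - c i j) ^ 2

/-- `Δ_ℓ(𝒳_V)`: the optimal `ℓ`-means cost of the spectral embedding multiset `𝒳_V`
(which contains `d_u` copies of `F(u)` for every vertex `u`). -/
noncomputable def kmOpt (G : SimpleGraph V) [DecidableRel G.Adj]
    (f : Fin (Fintype.card V) → V → ℝ) {k : ℕ} (hk : k ≤ Fintype.card V) (ℓ : ℕ) : ℝ :=
  sInf { r : ℝ | ∃ (A : Fin ℓ → Finset V) (c : Fin ℓ → Fin k → ℝ),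
    (∀ i j, i ≠ j → Disjoint (A i) (A j)) ∧ (∀ v : V, ∃ i, v ∈ A i) ∧
    r = kmCost G f hk A c }

/-- Normalized characteristic vector `ḡ_i = D^{1/2} χ_{P_i} / √μ(P_i)`. -/
noncomputable def gbar (G : SimpleGraph V) [DecidableRel G.Adj] {k : ℕ}
    (P : Fin k → Finset V) (i : Fin k) : V → ℝ :=
  fun v => (if v ∈ P i then Real.sqrt (G.degree v) else 0) / Real.sqrt (vol G (P i))

/-- Coefficients `α_j^{(i)} = ⟨ḡ_i, f_j⟩` of `ḡ_i` in the eigenbasis. -/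
noncomputable def alpha (G : SimpleGraph V) [DecidableRel G.Adj] {k : ℕ}
    (P : Fin k → Finset V) (f : Fin (Fintype.card V) → V → ℝ)
    (i : Fin k) (j : Fin (Fintype.card V)) : ℝ :=
  dotV (gbar G P i) (f j)

/-- Projection `f̂_i = ∑_{j=1}^k α_j^{(i)} f_j` of `ḡ_i` onto the first `k` eigenvectors. -/
noncomputable def fhat (G : SimpleGraph V) [DecidableRel G.Adj] {k : ℕ}
    (P : Fin k → Finset V) (f : Fin (Fintype.card V) → V → ℝ) (i : Fin k) : V → ℝ :=
  fun v => ∑ j : Fin (Fintype.card V),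
    if (j : ℕ) < k then alpha G P f i j * f j v else 0

/-- Estimation center `p^{(i)} = μ(P_i)^{-1/2} (β_i^{(1)}, …, β_i^{(k)})`;
here `beta i j` denotes `β_j^{(i)}`. -/
noncomputable def estCenter (G : SimpleGraph V) [DecidableRel G.Adj] {k : ℕ}
    (P : Fin k → Finset V) (beta : Fin k → Fin k → ℝ) (i : Fin k) : Fin k → ℝ :=
  fun j => beta j i / Real.sqrt (vol G (P i))

/-- The quadratic form of the normalized Laplacian as a sum over ordered pairs of adjacent
vertices. -/
theorem dotV_normLap {V : Type} [Fintype V] [DecidableEq V] (G : SimpleGraph V)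
    [DecidableRel G.Adj] (hd : ∀ v : V, 0 < G.degree v) (x : V → ℝ) :
    dotV x ((normLap G).mulVec x) =
      (∑ u, ∑ v, if G.Adj u v then
        (x u / Real.sqrt (G.degree u) - x v / Real.sqrt (G.degree v)) ^ 2 else 0) / 2 := by
  set y : V → ℝ := fun v => x v / Real.sqrt (G.degree v) with hy
  have hsq : ∀ u, x u * x u = ∑ v, if G.Adj u v then y u ^ 2 else 0 := by
    intro u
    have h0 : (0 : ℝ) < G.degree u := by exact_mod_cast hd u
    have hs : ∑ v, (if G.Adj u v then y u ^ 2 else 0) = (G.degree u : ℝ) * y u ^ 2 := by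
      rw [← Finset.sum_filter, Finset.sum_const, ← G.card_neighborFinset_eq_degree,
        G.neighborFinset_eq_filter, nsmul_eq_mul]
    rw [hs]
    simp only [hy, div_pow, Real.sq_sqrt h0.le]
    field_simp
  have hmul : ∀ u, (normLap G).mulVec x u = x u - ∑ v, if G.Adj u v then
      (Real.sqrt (G.degree u))⁻¹ * y v else 0 := by
    intro u
    rw [normLap, Matrix.sub_mulVec, Matrix.one_mulVec, Pi.sub_apply]
    congr 1
    rw [Matrix.mulVec, dotProduct]
    refine Finset.sum_congr rfl fun v _ => ?_
    rw [Matrix.mul_diagonal, Matrix.diagonal_mul, SimpleGraph.adjMatrix_apply]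
    split_ifs
    · simp only [hy]; ring
    · simp
  have hswap : ∑ u, ∑ v, (if G.Adj u v then y v ^ 2 else 0) = ∑ u, x u * x u := by
    rw [Finset.sum_comm]
    refine Finset.sum_congr rfl fun u _ => ?_
    rw [hsq u]
    exact Finset.sum_congr rfl fun v _ => by simp only [G.adj_comm]
  have hexp : ∑ u, ∑ v, (if G.Adj u v then (y u - y v) ^ 2 else 0) =
      ∑ u, ∑ v, (if G.Adj u v then y u ^ 2 else 0)
        + ∑ u, ∑ v, (if G.Adj u v then y v ^ 2 else 0)
        - 2 * ∑ u, ∑ v, (if G.Adj u v then y u * y v else 0) := by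
    simp only [Finset.mul_sum, ← Finset.sum_add_distrib, ← Finset.sum_sub_distrib]
    refine Finset.sum_congr rfl fun u _ => Finset.sum_congr rfl fun v _ => ?_
    split_ifs <;> ring
  have hlhs : dotV x ((normLap G).mulVec x) =
      ∑ u, x u * x u - ∑ u, ∑ v, (if G.Adj u v then y u * y v else 0) := by
    rw [dotV, ← Finset.sum_sub_distrib]
    refine Finset.sum_congr rfl fun u _ => ?_
    rw [hmul, mul_sub, Finset.mul_sum]
    congr 1
    refine Finset.sum_congr rfl fun v _ => ?_
    split_ifs
    · simp only [hy]; ring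
    · simp
  have hself : ∑ u, ∑ v, (if G.Adj u v then y u ^ 2 else 0) = ∑ u, x u * x u :=
    Finset.sum_congr rfl fun u _ => (hsq u).symm
  rw [hexp, hlhs, hswap, hself]
  ring

/-- The Rayleigh quotient of a normalized characteristic vector is the conductance. -/
theorem dotV_gbar_normLap {V : Type} [Fintype V] [DecidableEq V] (G : SimpleGraph V)
    [DecidableRel G.Adj] (hd : ∀ v : V, 0 < G.degree v) {k : ℕ} (P : Fin k → Finset V)
    (l : Fin k) :
    dotV (gbar G P l) ((normLap G).mulVec (gbar G P l)) = conductance G (P l) := by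
  rw [dotV_normLap G hd]
  have hdiv : ∀ u, gbar G P l u / Real.sqrt (G.degree u) =
      (if u ∈ P l then 1 else 0) / Real.sqrt (vol G (P l)) := by
    intro u
    have h0 : Real.sqrt (G.degree u) ≠ 0 :=
      (Real.sqrt_pos.2 (by exact_mod_cast hd u)).ne'
    unfold gbar
    split_ifs
    · field_simp
    · simp
  have hv : (0 : ℝ) ≤ vol G (P l) := Nat.cast_nonneg _
  have hterm : ∀ u v, (if G.Adj u v then (gbar G P l u / Real.sqrt (G.degree u)
        - gbar G P l v / Real.sqrt (G.degree v)) ^ 2 else 0) =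
      ((if u ∈ P l ∧ v ∉ P l ∧ G.Adj u v then 1 else 0)
        + (if v ∈ P l ∧ u ∉ P l ∧ G.Adj v u then 1 else 0)) / (vol G (P l) : ℝ) := by
    intro u v
    rw [hdiv, hdiv, ← sub_div, div_pow, Real.sq_sqrt hv]
    by_cases h : G.Adj u v <;> by_cases hu : u ∈ P l <;> by_cases hw : v ∈ P l <;>
      simp [h, hu, hw, G.adj_comm v u]
  have hcut : ∑ u, ∑ v, (if u ∈ P l ∧ v ∉ P l ∧ G.Adj u v then (1 : ℝ) else 0) =
      cut G (P l) (P l)ᶜ := by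
    rw [cut]
    rw [Nat.cast_sum, ← Finset.sum_filter_add_sum_filter_not Finset.univ (· ∈ P l)]
    rw [Finset.sum_eq_zero (s := Finset.univ.filter (· ∉ P l)), add_zero,
      Finset.filter_univ_mem]
    · refine Finset.sum_congr rfl fun u hu => ?_
      rw [Finset.card_filter, Nat.cast_sum, ← Finset.sum_subset (Finset.subset_univ (P l)ᶜ)]
      · refine Finset.sum_congr rfl fun v hv => ?_
        simp [hu, Finset.mem_compl.1 hv]
      · intro v _ hv
        simp_all
    · intro u hu
      simp only [Finset.mem_filter] at hu
      simp [hu.2]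
  simp only [hterm, ← Finset.sum_div, Finset.sum_add_distrib]
  rw [Finset.sum_comm (f := fun u v => if v ∈ P l ∧ u ∉ P l ∧ G.Adj v u then (1 : ℝ) else 0),
    hcut, conductance]
  ring

/-- An orthonormal family of `|V|` vectors is complete. -/
theorem EigenData.complete {V : Type} [Fintype V] [DecidableEq V] {G : SimpleGraph V}
    [DecidableRel G.Adj] {f : Fin (Fintype.card V) → V → ℝ} {lam : Fin (Fintype.card V) → ℝ}
    (hf : EigenData G f lam) (u v : V) :
    ∑ i, f i u * f i v = if u = v then 1 else 0 := by
  let M : Matrix (Fin (Fintype.card V)) V ℝ := Matrix.of f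
  have h1 : M * Mᵀ = 1 := by
    ext i j
    rw [Matrix.mul_apply, Matrix.one_apply, ← hf.ortho i j]
    rfl
  have h2 : Mᵀ * M = 1 :=
    (Matrix.mul_eq_one_comm_of_equiv (Fintype.equivFin V).symm).1 h1
  have h3 := congrFun (congrFun h2 u) v
  rw [Matrix.mul_apply, Matrix.one_apply] at h3
  exact h3

theorem EigenData.expand {V : Type} [Fintype V] [DecidableEq V] {G : SimpleGraph V}
    [DecidableRel G.Adj] {f : Fin (Fintype.card V) → V → ℝ} {lam : Fin (Fintype.card V) → ℝ}
    (hf : EigenData G f lam) (x : V → ℝ) (v : V) :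
    ∑ i, dotV x (f i) * f i v = x v := by
  simp only [dotV, Finset.sum_mul]
  rw [Finset.sum_comm]
  simp only [mul_assoc, ← Finset.mul_sum, hf.complete]
  simp

/-- The inner product of two combinations of an orthonormal family. -/
theorem dotV_sum_of_orthonormal {V ι : Type} [Fintype V] [Fintype ι] [DecidableEq ι]
    {g : ι → V → ℝ} (hg : ∀ i j, dotV (g i) (g j) = if i = j then 1 else 0) (a b : ι → ℝ) :
    dotV (fun v => ∑ i, a i * g i v) (fun v => ∑ i, b i * g i v) = ∑ i, a i * b i := by
  have h : ∀ i, ∑ j, a i * b j * dotV (g i) (g j) = a i * b i := by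
    intro i
    simp [hg]
  simp only [← h]
  simp only [dotV, Finset.sum_mul_sum]
  simp only [Finset.mul_sum]
  rw [Finset.sum_comm]
  refine Finset.sum_congr rfl fun i _ => ?_
  rw [Finset.sum_comm]
  exact Finset.sum_congr rfl fun j _ => Finset.sum_congr rfl fun v _ => by ring

/-- Spectral decomposition of the quadratic form of the normalized Laplacian. -/
theorem EigenData.dotV_normLap_eq {V : Type} [Fintype V] [DecidableEq V] {G : SimpleGraph V}
    [DecidableRel G.Adj] {f : Fin (Fintype.card V) → V → ℝ} {lam : Fin (Fintype.card V) → ℝ}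
    (hf : EigenData G f lam) (x : V → ℝ) :
    dotV x ((normLap G).mulVec x) = ∑ i, lam i * dotV x (f i) ^ 2 := by
  have hx : x = ∑ i, dotV x (f i) • f i := by
    ext v
    simp [hf.expand]
  have hL : (normLap G).mulVec x = fun v => ∑ i, (lam i * dotV x (f i)) * f i v := by
    conv_lhs => rw [hx]
    rw [Matrix.mulVec_sum]
    ext v
    simp only [Matrix.mulVec_smul, hf.eig, Finset.sum_apply, Pi.smul_apply, smul_eq_mul]
    exact Finset.sum_congr rfl fun i _ => by ring
  rw [hL]
  conv_lhs => rw [show x = fun v => ∑ i, dotV x (f i) * f i v from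
    funext fun v => (hf.expand x v).symm]
  simp only [hf.expand]
  have := dotV_sum_of_orthonormal hf.ortho (fun i => dotV x (f i)) (fun i => lam i * dotV x (f i))
  simp only [hf.expand] at this
  rw [this]
  exact Finset.sum_congr rfl fun i _ => by ring

theorem EigenData.lam_nonneg {V : Type} [Fintype V] [DecidableEq V] {G : SimpleGraph V}
    [DecidableRel G.Adj] {f : Fin (Fintype.card V) → V → ℝ} {lam : Fin (Fintype.card V) → ℝ}
    (hf : EigenData G f lam) (hd : ∀ v : V, 0 < G.degree v) (i : Fin (Fintype.card V)) :
    0 ≤ lam i := by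
  have h : dotV (f i) ((normLap G).mulVec (f i)) = lam i := by
    have h1 := hf.ortho i i
    rw [hf.eig]
    simp only [dotV, if_true, Pi.smul_apply, smul_eq_mul] at h1 ⊢
    conv_rhs => rw [← mul_one (lam i), ← h1, Finset.mul_sum]
    exact Finset.sum_congr rfl fun v _ => by ring
  rw [← h, dotV_normLap G hd]
  refine div_nonneg (Finset.sum_nonneg fun u _ => Finset.sum_nonneg fun v _ => ?_) two_pos.le
  split_ifs <;> positivity

/-- The part of `x` orthogonal to the first `k` eigenvectors is controlled by the Rayleigh
quotient of `x`. -/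
theorem EigenData.residual_le {V : Type} [Fintype V] [DecidableEq V] {G : SimpleGraph V}
    [DecidableRel G.Adj] {f : Fin (Fintype.card V) → V → ℝ} {lam : Fin (Fintype.card V) → ℝ}
    (hf : EigenData G f lam) (hd : ∀ v : V, 0 < G.degree v) {k : ℕ}
    (hkn : k < Fintype.card V) (x : V → ℝ) :
    lam ⟨k, hkn⟩ * ∑ v, (x v - ∑ j : Fin k,
        dotV x (f (Fin.castLE hkn.le j)) * f (Fin.castLE hkn.le j) v) ^ 2 ≤
      dotV x ((normLap G).mulVec x) := by
  let b : Fin (Fintype.card V) → ℝ := fun j => if (j : ℕ) < k then 0 else dotV x (f j)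
  have hb : ∀ v, x v - ∑ j : Fin k,
      dotV x (f (Fin.castLE hkn.le j)) * f (Fin.castLE hkn.le j) v = ∑ j, b j * f j v := by
    intro v
    have hs : ∑ j : Fin k, dotV x (f (Fin.castLE hkn.le j)) * f (Fin.castLE hkn.le j) v =
        ∑ j : Fin (Fintype.card V), if (j : ℕ) < k then dotV x (f j) * f j v else 0 := by
      rw [← Finset.sum_filter]
      refine Finset.sum_bij (fun j _ => Fin.castLE hkn.le j) ?_ ?_ ?_ ?_
      · intro j _
        simp
      · intro i _ j _ h
        exact Fin.castLE_injective _ h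
      · intro j hj
        exact ⟨⟨j, (Finset.mem_filter.1 hj).2⟩, Finset.mem_univ _, rfl⟩
      · intro j _
        rfl
    rw [hs]
    conv_lhs => rw [← hf.expand x v]
    rw [← Finset.sum_sub_distrib]
    refine Finset.sum_congr rfl fun j _ => ?_
    simp only [b]
    split_ifs <;> simp
  have hn := dotV_sum_of_orthonormal hf.ortho b b
  simp only [dotV, ← sq] at hn
  simp only [hb]
  rw [hn, hf.dotV_normLap_eq, Finset.mul_sum]
  refine Finset.sum_le_sum fun j _ => ?_
  simp only [b]
  split_ifs with h
  · have := hf.lam_nonneg hd j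
    simp only [ne_eq, OfNat.ofNat_ne_zero, not_false_eq_true, zero_pow, mul_zero]
    positivity
  · exact mul_le_mul_of_nonneg_right
      (hf.mono (Fin.mk_le_of_le_val (not_lt.1 h))) (sq_nonneg _)

/-- Summing over the blocks of a family indexed by labels amounts to summing over vertices. -/
theorem sum_blocks {V : Type} [Fintype V] [DecidableEq V] {k : ℕ} {A : Fin k → Finset V}
    {a : V → Fin k} (ha : ∀ v i, v ∈ A i ↔ a v = i) (h : Fin k → V → ℝ) :
    ∑ i, ∑ v ∈ A i, h i v = ∑ v, h (a v) v := by
  have : ∀ i, ∑ v ∈ A i, h i v = ∑ v, if a v = i then h i v else 0 := by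
    intro i
    rw [← Finset.sum_filter]
    exact Finset.sum_congr (by ext v; simp [ha]) fun _ _ => rfl
  simp only [this]
  rw [Finset.sum_comm]
  simp

/-- Bessel's inequality for the normalized characteristic vectors of a partition. -/
theorem sum_dotV_gbar_sq_le {V : Type} [Fintype V] [DecidableEq V] (G : SimpleGraph V)
    [DecidableRel G.Adj] {k : ℕ} {P : Fin k → Finset V} {p : V → Fin k}
    (hp : ∀ v i, v ∈ P i ↔ p v = i) (w : V → ℝ) :
    ∑ l, dotV (gbar G P l) w ^ 2 ≤ ∑ v, w v ^ 2 := by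
  rw [← sum_blocks hp fun _ v => w v ^ 2]
  refine Finset.sum_le_sum fun l _ => ?_
  have h1 : dotV (gbar G P l) w =
      (∑ v ∈ P l, Real.sqrt (G.degree v) * w v) / Real.sqrt (vol G (P l)) := by
    rw [dotV, Finset.sum_div, ← Finset.sum_subset (Finset.subset_univ (P l))]
    · refine Finset.sum_congr rfl fun v hv => ?_
      simp only [gbar, hv, if_true]
      ring
    · intro v _ hv
      simp [gbar, hv]
  have h2 := Finset.sum_mul_sq_le_sq_mul_sq (P l) (fun v => Real.sqrt (G.degree v)) w
  have h3 : ∑ v ∈ P l, Real.sqrt (G.degree v) ^ 2 = (vol G (P l) : ℝ) := by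
    rw [vol]
    push_cast
    exact Finset.sum_congr rfl fun v _ => Real.sq_sqrt (Nat.cast_nonneg _)
  have h4 : (0 : ℝ) ≤ vol G (P l) := Nat.cast_nonneg _
  rw [h3] at h2
  rw [h1, div_pow, Real.sq_sqrt h4]
  exact div_le_of_le_mul₀ h4 (Finset.sum_nonneg fun _ _ => sq_nonneg _) (by linarith)

/-- If every relabelling of the clusters `a` misses some block of `p` by a fraction `η`, then
the cost of clustering the points `e_{p v} / √(m (p v))` according to `a` is at least `η / 4`. -/
theorem le_four_mul_cost {V : Type} [Fintype V] {k : ℕ} {η : ℝ} (hη : 2 ≤ k → η ≤ 1)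
    (d : V → ℝ) (hd : ∀ v, 0 ≤ d v) (a p : V → Fin k) (m : Fin k → ℝ) (hm : ∀ j, 0 < m j)
    (hmd : ∀ j, m j = ∑ v, if p v = j then d v else 0)
    (hperm : ∀ π : Equiv.Perm (Fin k), ∃ i, η * m (π i) ≤
      ∑ v, if ¬(a v = i ↔ p v = π i) then d v else 0)
    (c : Fin k → Fin k → ℝ) :
    η ≤ 4 * ∑ v, d v * ∑ l, ((if p v = l then 1 else 0) / Real.sqrt (m l) - c (a v) l) ^ 2 := by
  classical
  let q : Fin k → Fin k → ℝ := fun j l => (if j = l then 1 else 0) / Real.sqrt (m l)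
  let D : Fin k → Fin k → ℝ := fun i j => ∑ l, (q j l - c i l) ^ 2
  have hσ : ∀ i : Fin k, ∃ j, ∀ j', D i j ≤ D i j' := fun i =>
    haveI : Nonempty (Fin k) := ⟨i⟩
    Finite.exists_min (D i)
  choose σ hσ using hσ
  have hqq : ∀ j j', j ≠ j' → ∑ l, (q j l - q j' l) ^ 2 = 1 / m j + 1 / m j' := by
    intro j j' h
    have : ∀ l, (q j l - q j' l) ^ 2 =
        (if j = l then 1 / m l else 0) + (if j' = l then 1 / m l else 0) := by
      intro l
      simp only [q]
      rw [← sub_div, div_pow, Real.sq_sqrt (hm l).le]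
      by_cases h1 : j = l
      · subst h1
        simp [h.symm]
      · by_cases h2 : j' = l <;> simp [h1, h2]
    simp [this, Finset.sum_add_distrib]
  have hfar : ∀ i j, j ≠ σ i → 1 / m j + 1 / m (σ i) ≤ 4 * D i j := by
    intro i j h
    rw [← hqq j _ h]
    have h1 : ∑ l, (q j l - q (σ i) l) ^ 2 ≤ 2 * D i j + 2 * D i (σ i) := by
      simp only [D, Finset.mul_sum, ← Finset.sum_add_distrib]
      refine Finset.sum_le_sum fun l _ => ?_
      nlinarith [sq_nonneg ((q j l - c i l) + (q (σ i) l - c i l))]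
    linarith [hσ i j]
  have hD0 : ∀ i j, 0 ≤ D i j := fun i j => Finset.sum_nonneg fun _ _ => sq_nonneg _
  have hlow : ∀ i j, (if j ≠ σ i then 1 / m j + 1 / m (σ i) else 0) ≤ 4 * D i j := by
    intro i j
    split_ifs with h
    · exact hfar i j h
    · linarith [hD0 i j]
  have hcost : ∀ t : V → ℝ,
      (∀ v, t v ≤ if p v ≠ σ (a v) then 1 / m (p v) + 1 / m (σ (a v)) else 0) →
      ∑ v, d v * t v ≤ 4 * ∑ v, d v * D (a v) (p v) := by
    intro t ht
    rw [Finset.mul_sum]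
    refine Finset.sum_le_sum fun v _ => ?_
    nlinarith [mul_le_mul_of_nonneg_left ((ht v).trans (hlow (a v) (p v))) (hd v)]
  have hinv : ∀ j, 0 < 1 / m j := fun j => one_div_pos.2 (hm j)
  change η ≤ 4 * ∑ v, d v * D (a v) (p v)
  by_cases hbij : Function.Surjective σ
  · have hb : Function.Bijective σ := Finite.surjective_iff_bijective.1 hbij
    obtain ⟨i, hi⟩ := hperm (Equiv.ofBijective σ hb)
    simp only [Equiv.ofBijective_apply] at hi
    refine le_trans ?_ (hcost
      (fun v => if ¬(a v = i ↔ p v = σ i) then 1 / m (σ i) else 0) ?_)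
    · rw [← le_div_iff₀ (hm _), Finset.sum_div] at hi
      refine hi.trans (Finset.sum_le_sum fun v _ => ?_)
      split_ifs <;> simp [div_eq_mul_inv]
    · intro v
      have h1 := hinv (p v)
      have h2 := hinv (σ (a v))
      by_cases hx : ¬(a v = i ↔ p v = σ i)
      · rw [if_pos hx]
        by_cases h : a v = i
        · subst h
          rw [if_pos (by tauto)]
          linarith
        · have hpi : p v = σ i := by tauto
          have hne : p v ≠ σ (a v) := fun e => h (hb.1 (e.symm.trans hpi))
          rw [if_pos hne, ← hpi]
          linarith
      · rw [if_neg hx]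
        split_ifs <;> linarith
  · obtain ⟨j, hj⟩ := not_forall.1 hbij
    have hj : ∀ i, σ i ≠ j := fun i h => hj ⟨i, h⟩
    have hk : 2 ≤ k := by
      have h1 := (σ j).isLt
      have h2 := j.isLt
      have h3 : (σ j : ℕ) ≠ j := fun h => hj j (Fin.ext h)
      omega
    refine (hη hk).trans (le_trans ?_ (hcost (fun v => if p v = j then 1 / m j else 0) ?_))
    · have h1 : ∑ v, d v * (if p v = j then 1 / m j else 0) = 1 := by
        simp only [mul_ite, mul_zero, mul_one_div]
        rw [← div_self (hm j).ne']
        nth_rewrite 2 [hmd j]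
        rw [Finset.sum_div]
        exact Finset.sum_congr rfl fun v _ => by split_ifs <;> simp
      exact h1.ge
    · intro v
      have h1 := hinv (p v)
      have h2 := hinv (σ (a v))
      by_cases h : p v = j
      · rw [if_pos h, if_pos (h ▸ (hj _).symm), ← h]
        linarith
      · rw [if_neg h]
        split_ifs <;> linarith

/-- The cost of any clustering of the spectral embedding controls the cost of the same clustering
for the ideal points `e_l / √μ(P_l)`, up to the residual of the projections. -/
theorem exists_ideal_cost_le {V : Type} [Fintype V] [DecidableEq V] (G : SimpleGraph V)
    [DecidableRel G.Adj] (hd : ∀ v : V, 0 < G.degree v) {k : ℕ} (hkn : k < Fintype.card V)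
    {f : Fin (Fintype.card V) → V → ℝ} {lam : Fin (Fintype.card V) → ℝ}
    (hf : EigenData G f lam) {P A : Fin k → Finset V} {p a : V → Fin k}
    (hp : ∀ v i, v ∈ P i ↔ p v = i) (ha : ∀ v i, v ∈ A i ↔ a v = i)
    (hlam : 0 < lam ⟨k, hkn⟩) (c : Fin k → Fin k → ℝ) :
    ∃ c' : Fin k → Fin k → ℝ,
      ∑ v, (G.degree v : ℝ) *
          ∑ l, ((if p v = l then 1 else 0) / Real.sqrt (vol G (P l)) - c' (a v) l) ^ 2 ≤
        2 * kmCost G f hkn.le A c + 2 * ((∑ l, conductance G (P l)) / lam ⟨k, hkn⟩) := by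
  let g : Fin k → V → ℝ := fun j => f (Fin.castLE hkn.le j)
  let B : Fin k → Fin k → ℝ := fun l j => dotV (gbar G P l) (g j)
  let r : Fin k → V → ℝ := fun l v => gbar G P l v - ∑ j, B l j * g j v
  have hr : ∑ l, ∑ v, r l v ^ 2 ≤ (∑ l, conductance G (P l)) / lam ⟨k, hkn⟩ := by
    rw [le_div_iff₀ hlam, mul_comm, Finset.mul_sum]
    refine Finset.sum_le_sum fun l _ => ?_
    rw [← dotV_gbar_normLap G hd]
    exact hf.residual_le hd hkn _
  have hg : ∀ i j, dotV (g i) (g j) = if i = j then 1 else 0 := by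
    intro i j
    rw [hf.ortho]
    simp
  have hB : ∀ y : Fin k → ℝ, ∑ l, (∑ j, B l j * y j) ^ 2 ≤ ∑ j, y j ^ 2 := by
    intro y
    have h1 := sum_dotV_gbar_sq_le G hp fun v => ∑ j, y j * g j v
    have h2 : ∀ l, dotV (gbar G P l) (fun v => ∑ j, y j * g j v) = ∑ j, B l j * y j := by
      intro l
      simp only [B, dotV, Finset.mul_sum, Finset.sum_mul]
      rw [Finset.sum_comm]
      exact Finset.sum_congr rfl fun j _ => Finset.sum_congr rfl fun v _ => by ring
    have h3 : ∑ v, (∑ j, y j * g j v) ^ 2 = ∑ j, y j ^ 2 := by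
      simpa only [dotV, ← sq] using dotV_sum_of_orthonormal hg y y
    simpa only [h2, h3] using h1
  refine ⟨fun i l => ∑ j, B l j * c i j, ?_⟩
  have hcost : kmCost G f hkn.le A c =
      ∑ v, ∑ j, (g j v - Real.sqrt (G.degree v) * c (a v) j) ^ 2 := by
    rw [kmCost, sum_blocks ha
      fun i u => (G.degree u : ℝ) * ∑ j, (Femb G f hkn.le u j - c i j) ^ 2]
    refine Finset.sum_congr rfl fun v _ => ?_
    rw [Finset.mul_sum]
    refine Finset.sum_congr rfl fun j _ => ?_
    have h0 : (0 : ℝ) < G.degree v := by exact_mod_cast hd v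
    have h1 : Real.sqrt (G.degree v) ≠ 0 := (Real.sqrt_pos.2 h0).ne'
    have h2 : g j v - Real.sqrt (G.degree v) * c (a v) j =
        Real.sqrt (G.degree v) * (Femb G f hkn.le v j - c (a v) j) := by
      simp only [Femb, g]
      field_simp
    rw [h2, mul_pow, Real.sq_sqrt h0.le]
  rw [Finset.sum_comm] at hr
  refine le_trans ?_ (add_le_add_right (mul_le_mul_of_nonneg_left hr two_pos.le) _)
  rw [hcost, Finset.mul_sum, Finset.mul_sum, ← Finset.sum_add_distrib]
  refine Finset.sum_le_sum fun v _ => ?_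
  refine le_trans ?_ (add_le_add_left (mul_le_mul_of_nonneg_left
    (hB fun j => g j v - Real.sqrt (G.degree v) * c (a v) j) two_pos.le) _)
  rw [Finset.mul_sum, Finset.mul_sum, Finset.mul_sum, ← Finset.sum_add_distrib]
  refine Finset.sum_le_sum fun l _ => ?_
  have h0 : (0 : ℝ) ≤ G.degree v := Nat.cast_nonneg _
  have h1 : Real.sqrt (G.degree v) * ((if p v = l then 1 else 0) / Real.sqrt (vol G (P l))
      - ∑ j, B l j * c (a v) j) =
      ∑ j, B l j * (g j v - Real.sqrt (G.degree v) * c (a v) j) + r l v := by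
    have h2 : Real.sqrt (G.degree v) * ((if p v = l then 1 else 0) / Real.sqrt (vol G (P l))) =
        gbar G P l v := by
      simp only [gbar, hp]
      split_ifs <;> simp [div_eq_mul_inv]
    have h3 : ∑ j, B l j * (g j v - Real.sqrt (G.degree v) * c (a v) j) =
        ∑ j, B l j * g j v - Real.sqrt (G.degree v) * ∑ j, B l j * c (a v) j := by
      rw [Finset.mul_sum, ← Finset.sum_sub_distrib]
      exact Finset.sum_congr rfl fun j _ => by ring
    rw [mul_sub, h2, h3]
    simp only [r]
    ring
  rw [← Real.sq_sqrt h0, ← mul_pow, Real.sq_sqrt h0, h1]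
  nlinarith [sq_nonneg (∑ j, B l j * (g j v - Real.sqrt (G.degree v) * c (a v) j) - r l v)]

/-- Disjoint sets covering `V` are the fibres of a labelling. -/
theorem exists_label {V : Type} {k : ℕ} {A : Fin k → Finset V}
    (hdisj : ∀ i j, i ≠ j → Disjoint (A i) (A j)) (hcover : ∀ v : V, ∃ i, v ∈ A i) :
    ∃ a : V → Fin k, ∀ v i, v ∈ A i ↔ a v = i := by
  choose a ha using hcover
  refine ⟨a, fun v i => ⟨fun h => ?_, fun h => h ▸ ha v⟩⟩
  by_contra hne
  exact Finset.disjoint_left.1 (hdisj _ _ hne) (ha v) h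

theorem cost_lower_bound_far_partitions
    {V : Type} [Fintype V] [DecidableEq V] (G : SimpleGraph V) [DecidableRel G.Adj]
    (hd : ∀ v : V, 0 < G.degree v)
    {k : ℕ} (hkn : k < Fintype.card V)
    (f : Fin (Fintype.card V) → V → ℝ) (lam : Fin (Fintype.card V) → ℝ)
    (hf : EigenData G f lam)
    (P : Fin k → Finset V) (hP : AchievesRhoAvr G P)
    (δ α ε : ℝ) (hδ0 : 0 < δ) (hδ1 : δ ≤ 1 / 2) (hα : 1 ≤ α)
    (hε0 : 0 < ε) (hε1 : ε < 1)
    (hPsi : Psi G lam P hkn = (20 : ℝ) ^ 4 * (k : ℝ) ^ 3 / δ)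
    (hε2 : ε ≥ 64 * α * (k : ℝ) ^ 3 / Psi G lam P hkn)
    (A : Fin k → Finset V)
    (hAdisj : ∀ i j, i ≠ j → Disjoint (A i) (A j))
    (hAcover : ∀ v : V, ∃ i, v ∈ A i)
    (c : Fin k → Fin k → ℝ)
    (hperm : ∀ π : Equiv.Perm (Fin k), ∃ i : Fin k,
      (vol G (symmDiff (A i) (P (π i))) : ℝ) ≥
        2 * ε / (k : ℝ) * (vol G (P (π i)) : ℝ)) :
    kmCost G f hkn.le A c > 2 * (k : ℝ) ^ 2 * α / Psi G lam P hkn := by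
  obtain ⟨⟨hPne, hPdisj, hPcover⟩, -, -⟩ := hP
  obtain ⟨p, hp⟩ := exists_label hPdisj hPcover
  obtain ⟨a, ha⟩ := exists_label hAdisj hAcover
  have hk : 0 < k := by
    obtain ⟨v⟩ : Nonempty V := Fintype.card_pos_iff.1 (by omega)
    exact (Nat.zero_le _).trans_lt (p v).isLt
  have hkR : (1 : ℝ) ≤ k := by exact_mod_cast hk
  have hΨ : 0 < Psi G lam P hkn := by
    rw [hPsi]
    positivity
  have hlam : 0 < lam ⟨k, hkn⟩ :=
    (hf.lam_nonneg hd _).lt_of_ne fun h => hΨ.ne' (by rw [Psi, ← h, zero_div])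
  have hres : (∑ l, conductance G (P l)) / lam ⟨k, hkn⟩ = k / Psi G lam P hkn := by
    rw [Psi, avgCond]
    field_simp
  have hvol : ∀ S : Finset V, (vol G S : ℝ) = ∑ v, if v ∈ S then (G.degree v : ℝ) else 0 := by
    intro S
    rw [vol, ← Finset.sum_filter, Finset.filter_univ_mem]
    push_cast
    rfl
  obtain ⟨c', hc'⟩ := exists_ideal_cost_le G hd hkn hf hp ha hlam c
  have hlow := le_four_mul_cost (η := 2 * ε / k)
    (fun h2 => by
      have : (2 : ℝ) ≤ k := by exact_mod_cast h2
      rw [div_le_one (by linarith)]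
      linarith)
    (fun v => (G.degree v : ℝ)) (fun v => Nat.cast_nonneg _) a p
    (fun j => (vol G (P j) : ℝ))
    (fun j => by
      exact_mod_cast Finset.sum_pos (fun v _ => hd v) (hPne j))
    (fun j => by simp only [hvol, hp])
    (fun π => by
      obtain ⟨i, hi⟩ := hperm π
      refine ⟨i, le_of_le_of_eq hi ?_⟩
      rw [hvol]
      refine Finset.sum_congr rfl fun v _ => if_congr ?_ rfl rfl
      rw [Finset.mem_symmDiff, ha, hp]
      tauto) c'
  rw [hres] at hc'
  have hαk : 64 * α * (k : ℝ) ^ 3 / Psi G lam P hkn =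
      32 * k * (2 * (k : ℝ) ^ 2 * α / Psi G lam P hkn) := by ring
  have hres_le : (k : ℝ) / Psi G lam P hkn ≤ 2 * (k : ℝ) ^ 2 * α / Psi G lam P hkn := by
    gcongr
    nlinarith [mul_nonneg (sub_nonneg.2 hkR) (sub_nonneg.2 hα)]
  rw [hαk] at hε2
  by_contra hcon
  have hεk : 2 * ε / k ≥ 64 * (2 * (k : ℝ) ^ 2 * α / Psi G lam P hkn) := by
    rw [ge_iff_le, le_div_iff₀ (by linarith)]
    linarith
  have hpos : 0 < 2 * (k : ℝ) ^ 2 * α / Psi G lam P hkn := by positivity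
  linarith [not_lt.1 hcon]

end SpectralClustering
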